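/- Let G = (V,E,w) be a weighted graph, S ⊆ V a subset of vertices, k ∈ S, and S′ = S ∖ {k}. Then |SDP(G[S]) − SDP(G[S′])| ≤ deg(k), where deg(k) = Σ_{i : (i,k)∈E} w_ik is the weighted degree of k in G[S]. Moreover the SDP value is monotone: SDP(G[S]) ≥ SDP(G[S′]). -/

import Mathlib

open scoped Classical
open Real Matrix

noncomputable section

/-- The Laplacian `L = D − A` of a weighted graph given by its weight matrix. -/
def lap {V : Type*} [Fintype V] (w : Matrix V V ℝ) : Matrix V V ℝ :=
  Matrix.of fun i j => if i = j then ∑ k, w i k else -(w i j)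

/-- The optimal value of the Goemans–Williamson SDP relaxation of max-cut:
`max (1/4)·Tr(L_G X)` over PSD matrices `X` with unit diagonal. -/
def sdpVal {V : Type*} [Fintype V] (w : Matrix V V ℝ) : ℝ :=
  sSup { v : ℝ | ∃ X : Matrix V V ℝ, X.PosSemidef ∧ (∀ i, X i i = 1) ∧
    v = (1 / 4) * (lap w * X).trace }

/-- The weight matrix of the vertex-induced subgraph `G[S]`. -/
def subw {n : ℕ} (w : Matrix (Fin n) (Fin n) ℝ) (S : Finset (Fin n)) :
    Matrix {i // i ∈ S} {i // i ∈ S} ℝ :=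
  Matrix.of fun i j => w i j

/-- The total edge weight `W = Σ_{(i,j)∈E} w_ij` (each undirected edge counted once). -/
def totalW {n : ℕ} (w : Matrix (Fin n) (Fin n) ℝ) : ℝ := (1 / 2) * ∑ i, ∑ j, w i j

/-- `E_{S_t}[SDP(G[S_t])]` where each vertex of `G` is kept independently with probability
`p`. -/
def esdp {n : ℕ} (w : Matrix (Fin n) (Fin n) ℝ) (p : ℝ) : ℝ :=
  ∑ S : Finset (Fin n), p ^ S.card * (1 - p) ^ (n - S.card) * sdpVal (subw w S)

/-- `G = (V,E,w)` is a weighted graph: symmetric nonnegative weights and no self-loops. -/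
def IsWeightedGraph {n : ℕ} (w : Matrix (Fin n) (Fin n) ℝ) : Prop :=
  (∀ i j, w i j = w j i) ∧ (∀ i j, 0 ≤ w i j) ∧ (∀ i, w i i = 0)

/-- Entries of a real positive semidefinite matrix with unit diagonal lie in `[-1, 1]`. -/
theorem abs_apply_le_one {V : Type*} [Fintype V] {X : Matrix V V ℝ} (hX : X.PosSemidef)
    (hd : ∀ i, X i i = 1) (i j : V) : |X i j| ≤ 1 := by
  have h := (hX.submatrix ![i, j]).det_nonneg
  have hs : X j i = X i j := by simpa using hX.1.apply i j
  simp only [det_fin_two, submatrix_apply, cons_val_zero, cons_val_one, hd, hs] at h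
  rw [abs_le_one_iff_mul_self_le_one]
  linarith

/-- The objective of the SDP relaxation of the induced subgraph on `S`, as a sum over edges. -/
def cutVal {n : ℕ} (w : Matrix (Fin n) (Fin n) ℝ) (S : Finset (Fin n))
    (X : Matrix (Fin n) (Fin n) ℝ) : ℝ :=
  (1 / 4) * ∑ i ∈ S, ∑ j ∈ S, w i j * (1 - X i j)

theorem trace_lap_mul {V : Type*} [Fintype V] {w X : Matrix V V ℝ} (hw : ∀ i, w i i = 0)
    (hX : X.PosSemidef) (hd : ∀ i, X i i = 1) :
    (lap w * X).trace = ∑ i, ∑ j, w i j * (1 - X i j) := by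
  refine Finset.sum_congr rfl fun i _ => ?_
  have hl : ∀ j, lap w i j * X j i = (if i = j then ∑ k, w i k else 0) - w i j * X i j := by
    intro j
    have hs : X j i = X i j := by simpa using hX.1.apply i j
    by_cases h : i = j
    · subst h
      simp [lap, hw, hd]
    · simp [lap, h, hs]
  simp only [diag_apply, mul_apply, hl, Finset.sum_sub_distrib, mul_sub, mul_one]
  simp

/-- A unit-diagonal positive semidefinite matrix on `S` extends to one on the whole index set. -/
theorem exists_posSemidef_extension {n : ℕ} {S : Finset (Fin n)}
    {X : Matrix {i // i ∈ S} {i // i ∈ S} ℝ} (hX : X.PosSemidef) (hd : ∀ i, X i i = 1) :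
    ∃ Y : Matrix (Fin n) (Fin n) ℝ, Y.PosSemidef ∧ (∀ i, Y i i = 1) ∧
      Y.submatrix (Subtype.val : {i // i ∈ S} → Fin n) Subtype.val = X := by
  let P : Matrix {i // i ∈ S} (Fin n) ℝ := Matrix.of fun s i => if (s : Fin n) = i then 1 else 0
  let d : Fin n → ℝ := fun i => if i ∈ S then 0 else 1
  have hin : ∀ a b : {i // i ∈ S}, (Pᴴ * X * P) a b = X a b := by
    intro a b
    simp [P, mul_apply]
  have hout : ∀ a, a ∉ S → (Pᴴ * X * P) a a = 0 := by
    intro a ha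
    have h0 : ∀ s, P s a = 0 := fun s => by
      have : (s : Fin n) ≠ a := fun h => ha (h ▸ s.2)
      simp [P, this]
    simp [mul_apply, h0]
  refine ⟨Pᴴ * X * P + diagonal d, (hX.conjTranspose_mul_mul_same P).add
    (PosSemidef.diagonal fun i => ?_), fun i => ?_, ?_⟩
  · by_cases h : i ∈ S <;> simp [d, h]
  · by_cases h : i ∈ S
    · rw [Matrix.add_apply, hin ⟨i, h⟩ ⟨i, h⟩, hd]
      simp [d, h]
    · rw [Matrix.add_apply, hout i h]
      simp [d, h]
  · ext a b
    rw [submatrix_apply, Matrix.add_apply, hin]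
    simp [diagonal_apply, d]

theorem sdpVal_subw {n : ℕ} (w : Matrix (Fin n) (Fin n) ℝ) (hw : IsWeightedGraph w)
    (S : Finset (Fin n)) :
    sdpVal (subw w S) = sSup { v : ℝ | ∃ X : Matrix (Fin n) (Fin n) ℝ, X.PosSemidef ∧
      (∀ i, X i i = 1) ∧ v = cutVal w S X } := by
  have key : ∀ Y : Matrix (Fin n) (Fin n) ℝ, Y.PosSemidef → (∀ i, Y i i = 1) →
      (1 / 4) * (lap (subw w S) *
        Y.submatrix (Subtype.val : {i // i ∈ S} → Fin n) Subtype.val).trace =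
      cutVal w S Y := by
    intro Y hY hd
    rw [trace_lap_mul (w := subw w S) (fun i => hw.2.2 i) (hY.submatrix Subtype.val)
      (fun i => hd i), cutVal, ← Finset.sum_coe_sort S]
    simp_rw [← Finset.sum_coe_sort S]
    rfl
  unfold sdpVal
  congr 1
  ext v
  constructor
  · rintro ⟨X, hX, hd, rfl⟩
    obtain ⟨Y, hY, hYd, rfl⟩ := exists_posSemidef_extension hX hd
    exact ⟨Y, hY, hYd, key Y hY hYd⟩
  · rintro ⟨Y, hY, hYd, rfl⟩
    exact ⟨_, hY.submatrix _, fun i => hYd i, (key Y hY hYd).symm⟩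

theorem bddAbove_cutVal {n : ℕ} (w : Matrix (Fin n) (Fin n) ℝ) (hw : IsWeightedGraph w)
    (S : Finset (Fin n)) :
    BddAbove { v : ℝ | ∃ X : Matrix (Fin n) (Fin n) ℝ, X.PosSemidef ∧
      (∀ i, X i i = 1) ∧ v = cutVal w S X } := by
  refine ⟨(1 / 4) * ∑ i ∈ S, ∑ j ∈ S, w i j * 2, ?_⟩
  rintro _ ⟨X, hX, hd, rfl⟩
  unfold cutVal
  gcongr with i _ j _
  · exact hw.2.1 i j
  · linarith [(abs_le.1 (abs_apply_le_one hX hd i j)).1]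

/-- Deleting a vertex `k` decreases the objective by an amount between `0` and the degree
of `k`. -/
theorem cutVal_erase_le {n : ℕ} (w : Matrix (Fin n) (Fin n) ℝ) (hw : IsWeightedGraph w)
    {S : Finset (Fin n)} {k : Fin n} (hk : k ∈ S) {X : Matrix (Fin n) (Fin n) ℝ}
    (hX : X.PosSemidef) (hd : ∀ i, X i i = 1) :
    cutVal w (S.erase k) X ≤ cutVal w S X ∧
      cutVal w S X ≤ cutVal w (S.erase k) X + ∑ i ∈ S, w i k := by
  have hs : ∀ i, w k i * (1 - X k i) = w i k * (1 - X i k) := fun i => by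
    have : X k i = X i k := by simpa using hX.1.apply i k
    rw [hw.1 k i, this]
  have heq : cutVal w S X =
      cutVal w (S.erase k) X + (1 / 2) * ∑ i ∈ S.erase k, w i k * (1 - X i k) := by
    simp only [cutVal, ← Finset.add_sum_erase S _ hk, Finset.sum_add_distrib, hs, hw.2.2 k]
    ring
  have hnn : 0 ≤ ∑ i ∈ S.erase k, w i k * (1 - X i k) :=
    Finset.sum_nonneg fun i _ => mul_nonneg (hw.2.1 i k)
      (by linarith [(abs_le.1 (abs_apply_le_one hX hd i k)).2])
  have hub : ∑ i ∈ S.erase k, w i k * (1 - X i k) ≤ ∑ i ∈ S.erase k, w i k * 2 := by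
    gcongr with i _
    · exact hw.2.1 i k
    · linarith [(abs_le.1 (abs_apply_le_one hX hd i k)).1]
  rw [← Finset.sum_mul] at hub
  rw [heq, ← Finset.add_sum_erase S (fun i => w i k) hk, hw.2.2 k]
  constructor <;> linarith

/-- For `S ⊆ V`, `k ∈ S` and `S′ = S ∖ {k}`:
`|SDP(G[S]) − SDP(G[S′])| ≤ deg(k)` where `deg(k) = Σ_{i∈S} w_ik` is the weighted degree of `k`
in `G[S]`; moreover the SDP value is monotone, `SDP(G[S]) ≥ SDP(G[S′])`. -/
theorem stmt15 {n : ℕ} (w : Matrix (Fin n) (Fin n) ℝ) (hw : IsWeightedGraph w)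
    (S : Finset (Fin n)) (k : Fin n) (hk : k ∈ S) :
    |sdpVal (subw w S) - sdpVal (subw w (S.erase k))| ≤ ∑ i ∈ S, w i k ∧
      sdpVal (subw w (S.erase k)) ≤ sdpVal (subw w S) := by
  rw [sdpVal_subw w hw, sdpVal_subw w hw]
  set A := { v : ℝ | ∃ X : Matrix (Fin n) (Fin n) ℝ, X.PosSemidef ∧ (∀ i, X i i = 1) ∧
    v = cutVal w S X }
  set B := { v : ℝ | ∃ X : Matrix (Fin n) (Fin n) ℝ, X.PosSemidef ∧ (∀ i, X i i = 1) ∧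
    v = cutVal w (S.erase k) X }
  have hAne : A.Nonempty := ⟨_, 1, PosSemidef.one, by simp, rfl⟩
  have hBne : B.Nonempty := ⟨_, 1, PosSemidef.one, by simp, rfl⟩
  have hAb : BddAbove A := bddAbove_cutVal w hw S
  have hBb : BddAbove B := bddAbove_cutVal w hw _
  have hmono : sSup B ≤ sSup A := by
    refine csSup_le hBne ?_
    rintro _ ⟨X, hX, hd, rfl⟩
    exact (cutVal_erase_le w hw hk hX hd).1.trans (le_csSup hAb ⟨X, hX, hd, rfl⟩)
  have hle : sSup A ≤ sSup B + ∑ i ∈ S, w i k := by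
    refine csSup_le hAne ?_
    rintro _ ⟨X, hX, hd, rfl⟩
    exact (cutVal_erase_le w hw hk hX hd).2.trans
      (add_le_add_left (le_csSup hBb ⟨X, hX, hd, rfl⟩) _)
  exact ⟨by rw [abs_of_nonneg (sub_nonneg.2 hmono)]; linarith, hmono⟩
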